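/- arXiv:1805.02954 — 2 statements merged into one kernel-verified Lean document; each statement's English description precedes it below -/
import Mathlib

section
/- The modified composition product on formal power series has the following properties: (1) it is left ℝ-linear, i.e., (αc + βc') ∘̃ d = α(c ∘̃ d) + β(c' ∘̃ d); (2) c ∘̃ 0 = c; (3) for any fixed d, c ∘̃ d equals a constant series k ∈ ℝ^ℓ (i.e., k·∅) if and only if c = k; (4) (x_0 c) ∘̃ d = x_0(c ∘̃ d) and (x_i c) ∘̃ d = x_i(c ∘̃ d) + x_0(d_i ⧢ (c ∘̃ d)) for 1 ≤ i ≤ m; (5) it distributes on the left over the shuffle product: (c ⧢ c') ∘̃ d = (c ∘̃ d) ⧢ (c' ∘̃ d). -/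
/-!
STATEMENT 0: The set ℝ^m⟨⟨X_δ⟩⟩ forms a group under the composition product;
equivalently, c ⊚ d := d + c ∘̃ d on ℝ^m⟨⟨X⟩⟩ is associative, has 0 as a two-sided
identity, and every c has a two-sided inverse.
-/

open scoped BigOperators

namespace FliessStmt

/-- Words over the alphabet `X = {x_0, …, x_m}`. -/
abbrev Word (m : ℕ) := List (Fin (m + 1))

/-- Formal power series over `X`: coefficient functions on words. -/
abbrev Series (m : ℕ) := Word m → ℝ

noncomputable section

variable (m : ℕ)

/-- The series `1 = 1∅`. -/
def one : Series m := fun ν => if ν = [] then 1 else 0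

/-- Left catenation by the letter `x_i`:  `e ↦ x_i e`. -/
def cat (i : Fin (m + 1)) (e : Series m) : Series m := fun ν =>
  match ν with
  | [] => 0
  | j :: ν' => if j = i then e ν' else 0

/-- The shuffle product of two words, as a formal power series (a polynomial):
`(x_i η) ⧢ (x_j ξ) = x_i(η ⧢ (x_j ξ)) + x_j((x_i η) ⧢ ξ)`, `∅ ⧢ η = η ⧢ ∅ = η`. -/
def shw : Word m → Word m → Series m
  | [], ξ => fun ν => if ν = ξ then 1 else 0
  | η, [] => fun ν => if ν = η then 1 else 0
  | i :: η, j :: ξ => cat m i (shw η (j :: ξ)) + cat m j (shw (i :: η) ξ)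
  termination_by η ξ => η.length + ξ.length

/-- The shuffle product, extended bilinearly to formal power series. -/
def sh (c d : Series m) : Series m := fun ν =>
  ∑ᶠ p : Word m × Word m, c p.1 * d p.2 * shw m p.1 p.2 ν

/-- For `d ∈ ℝ^m⟨⟨X⟩⟩`, the component `d_i` with the convention `d_0 := 0`. -/
def dsel (d : Fin m → Series m) (i : Fin (m + 1)) : Series m :=
  if h : i = 0 then 0 else d (i.pred h)

/-- `φ_d(x_i)(e) = x_i e + x_0 (d_i ⧢ e)`. -/
def phiStep (d : Fin m → Series m) (i : Fin (m + 1)) (e : Series m) : Series m :=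
  cat m i e + cat m 0 (sh m (dsel m d i) e)

/-- The homomorphism `φ_d` on words, `φ_d(∅) = id`, `φ_d(x_i η) = φ_d(x_i) ∘ φ_d(η)`. -/
def phi (d : Fin m → Series m) : Word m → Series m → Series m
  | [], e => e
  | i :: η, e => phiStep m d i (phi d η e)

/-- The modified composition product `c ∘̃ d = Σ_η (c,η) φ_d(η)(1)`
(the sum is locally finite, hence given coefficientwise by a finite sum). -/
def modcomp (c : Series m) (d : Fin m → Series m) : Series m := fun ν =>
  ∑ᶠ η : Word m, c η * phi m d η (one m) ν

/-- The modified composition product, componentwise for vector-valued `c`. -/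
def modcompV {ℓ : ℕ} (c : Fin ℓ → Series m) (d : Fin m → Series m) : Fin ℓ → Series m :=
  fun j => modcomp m (c j) d

/-- The group product `c ⊚ d := d + c ∘̃ d` on `ℝ^m⟨⟨X⟩⟩`
(so that `c_δ ∘ d_δ = δ + c ⊚ d`). -/
def gprod (c d : Fin m → Series m) : Fin m → Series m :=
  d + modcompV m c d


/-- The constant series `k = k∅` (vector-valued). -/
def constV {ℓ : ℕ} (k : Fin ℓ → ℝ) : Fin ℓ → Series m :=
  fun j => (k j) • one m

/-- The left derivative of a series by a letter, `(D_i c, ν) = (c, x_i ν)`. -/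
def leftDeriv {m : ℕ} (i : Fin (m + 1)) (c : Series m) : Series m := fun ν => c (i :: ν)

/-- The words of length at most `n`. -/
def wordsLE (m : ℕ) : ℕ → Finset (Word m)
  | 0 => {[]}
  | n + 1 => insert [] ((Finset.univ ×ˢ wordsLE m n).image fun p => p.1 :: p.2)

theorem mem_wordsLE {m n : ℕ} {η : Word m} : η ∈ wordsLE m n ↔ η.length ≤ n := by
  induction n generalizing η with
  | zero => simp [wordsLE]
  | succ n ih => cases η <;> simp [wordsLE, ih]

theorem sum_wordsLE_succ {m : ℕ} (n : ℕ) (F : Word m → ℝ) :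
    ∑ η ∈ wordsLE m (n + 1), F η = F [] + ∑ i, ∑ η ∈ wordsLE m n, F (i :: η) := by
  rw [wordsLE, Finset.sum_insert (by simp), Finset.sum_image, Finset.sum_product]
  rintro ⟨i, η⟩ _ ⟨j, ξ⟩ _ h
  simpa using h

section Shuffle

theorem shw_apply_nil {m : ℕ} (η ξ : Word m) :
    shw m η ξ [] = if η = [] ∧ ξ = [] then 1 else 0 := by
  cases η <;> cases ξ <;> simp [shw, cat]

theorem shw_nil_left {m : ℕ} (ξ ν : Word m) : shw m [] ξ ν = if ν = ξ then 1 else 0 := by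
  simp [shw]

theorem shw_nil_right {m : ℕ} (η ν : Word m) : shw m η [] ν = if ν = η then 1 else 0 := by
  cases η <;> simp [shw]

theorem shw_nil_nil_cons {m : ℕ} (k : Fin (m + 1)) (ν : Word m) : shw m [] [] (k :: ν) = 0 := by
  simp [shw]

theorem shw_cons_nil_cons {m : ℕ} (i k : Fin (m + 1)) (η ν : Word m) :
    shw m (i :: η) [] (k :: ν) = if k = i then shw m η [] ν else 0 := by
  simp [shw_nil_right, ite_and]

theorem shw_nil_cons_cons {m : ℕ} (j k : Fin (m + 1)) (ξ ν : Word m) :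
    shw m [] (j :: ξ) (k :: ν) = if k = j then shw m [] ξ ν else 0 := by
  simp [shw_nil_left, ite_and]

theorem shw_cons_cons_cons {m : ℕ} (i j k : Fin (m + 1)) (η ξ ν : Word m) :
    shw m (i :: η) (j :: ξ) (k :: ν) =
      (if k = i then shw m η (j :: ξ) ν else 0) + if k = j then shw m (i :: η) ξ ν else 0 := by
  rw [shw]
  rfl

theorem length_le_of_shw_ne_zero {m : ℕ} {η ξ ν : Word m} (h : shw m η ξ ν ≠ 0) :
    η.length ≤ ν.length ∧ ξ.length ≤ ν.length := by
  induction ν generalizing η ξ with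
  | nil =>
    rw [shw_apply_nil] at h
    simp_all
  | cons k ν ih =>
    rcases η with _ | ⟨i, η⟩ <;> rcases ξ with _ | ⟨j, ξ⟩
    · simp
    · rw [shw_nil_left] at h
      simp_all
    · rw [shw_nil_right] at h
      simp_all
    · rw [shw_cons_cons_cons] at h
      by_cases h₁ : (if k = i then shw m η (j :: ξ) ν else 0) = 0
      · rw [h₁, zero_add] at h
        have := ih (ite_ne_right_iff.1 h).2
        simp only [List.length_cons] at this ⊢
        omega
      · have := ih (ite_ne_right_iff.1 h₁).2
        simp only [List.length_cons] at this ⊢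
        omega

theorem sh_apply_eq_sum {m a b : ℕ} (c d : Series m) {ν : Word m} (ha : ν.length ≤ a)
    (hb : ν.length ≤ b) :
    sh m c d ν = ∑ η ∈ wordsLE m a, ∑ ξ ∈ wordsLE m b, c η * d ξ * shw m η ξ ν := by
  rw [sh, finsum_eq_sum_of_support_subset (s := wordsLE m a ×ˢ wordsLE m b), Finset.sum_product]
  intro p hp
  have := length_le_of_shw_ne_zero (right_ne_zero_of_mul hp)
  simp only [Finset.coe_product, Set.mem_prod, Finset.mem_coe, mem_wordsLE]
  omega

theorem sh_nil {m : ℕ} (c d : Series m) : sh m c d [] = c [] * d [] := by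
  rw [sh_apply_eq_sum c d (Nat.le_refl 0) (Nat.le_refl 0)]
  simp [wordsLE, shw_apply_nil]

theorem sh_cons {m : ℕ} (c d : Series m) (k : Fin (m + 1)) (ν : Word m) :
    sh m c d (k :: ν) = sh m (leftDeriv k c) d ν + sh m c (leftDeriv k d) ν := by
  have h : (k :: ν).length ≤ ν.length + 1 := by simp
  rw [sh_apply_eq_sum c d h h,
    sh_apply_eq_sum (leftDeriv k c) d le_rfl (Nat.le_succ _),
    sh_apply_eq_sum c (leftDeriv k d) (Nat.le_succ _) le_rfl]
  simp only [sum_wordsLE_succ, shw_nil_nil_cons, shw_nil_cons_cons, shw_cons_nil_cons,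
    shw_cons_cons_cons, mul_add, mul_ite, mul_zero, Finset.sum_add_distrib, leftDeriv,
    Finset.sum_ite_irrel, Finset.sum_const_zero, Finset.sum_ite_eq, Finset.mem_univ, if_true]
  ring

theorem sh_congr {m : ℕ} {c c' d d' : Series m} {ν : Word m}
    (hc : ∀ η : Word m, η.length ≤ ν.length → c η = c' η)
    (hd : ∀ η : Word m, η.length ≤ ν.length → d η = d' η) : sh m c d ν = sh m c' d' ν := by
  rw [sh_apply_eq_sum c d le_rfl le_rfl, sh_apply_eq_sum c' d' le_rfl le_rfl]
  refine Finset.sum_congr rfl fun η hη => Finset.sum_congr rfl fun ξ hξ => ?_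
  rw [hc η (mem_wordsLE.1 hη), hd ξ (mem_wordsLE.1 hξ)]

theorem sh_comm {m : ℕ} (c d : Series m) : sh m c d = sh m d c := by
  funext ν
  induction ν generalizing c d with
  | nil => rw [sh_nil, sh_nil, mul_comm]
  | cons k ν ih => rw [sh_cons, sh_cons, ih, ih c, add_comm]

theorem sh_add_right {m : ℕ} (c d e : Series m) : sh m c (d + e) = sh m c d + sh m c e := by
  funext ν
  simp only [Pi.add_apply, sh_apply_eq_sum _ _ (le_refl ν.length) (le_refl ν.length),
    mul_add, add_mul, Finset.sum_add_distrib]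

theorem sh_smul_right {m : ℕ} (a : ℝ) (c d : Series m) : sh m c (a • d) = a • sh m c d := by
  funext ν
  simp only [Pi.smul_apply, smul_eq_mul,
    sh_apply_eq_sum _ _ (le_refl ν.length) (le_refl ν.length), Finset.mul_sum]
  refine Finset.sum_congr rfl fun η _ => Finset.sum_congr rfl fun ξ _ => ?_
  ring

theorem sh_add_left {m : ℕ} (c d e : Series m) : sh m (c + d) e = sh m c e + sh m d e := by
  rw [sh_comm, sh_add_right, sh_comm e, sh_comm e]

theorem sh_zero_right {m : ℕ} (c : Series m) : sh m c 0 = 0 := by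
  simpa using sh_smul_right 0 c 0

theorem sh_zero_left {m : ℕ} (c : Series m) : sh m 0 c = 0 := by
  rw [sh_comm, sh_zero_right]

theorem sh_sum_right {m : ℕ} {ι : Type*} (s : Finset ι) (c : Series m) (f : ι → Series m) :
    sh m c (∑ i ∈ s, f i) = ∑ i ∈ s, sh m c (f i) := by
  classical
  induction s using Finset.induction_on with
  | empty => simp [sh_zero_right]
  | insert i s hi ih => rw [Finset.sum_insert hi, Finset.sum_insert hi, sh_add_right, ih]

theorem leftDeriv_sh {m : ℕ} (k : Fin (m + 1)) (c d : Series m) :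
    leftDeriv k (sh m c d) = sh m (leftDeriv k c) d + sh m c (leftDeriv k d) :=
  funext fun ν => sh_cons c d k ν

theorem sh_assoc {m : ℕ} (c d e : Series m) : sh m (sh m c d) e = sh m c (sh m d e) := by
  funext ν
  induction ν generalizing c d e with
  | nil => simp only [sh_nil, mul_assoc]
  | cons k ν ih =>
    simp only [sh_cons _ _ k ν, leftDeriv_sh, sh_add_left, sh_add_right, Pi.add_apply, ih,
      add_assoc]

theorem sh_left_comm {m : ℕ} (c d e : Series m) : sh m c (sh m d e) = sh m d (sh m c e) := by
  rw [← sh_assoc, sh_comm c d, sh_assoc]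

end Shuffle

section ModifiedComposition

theorem phi_one_eq_zero_of_length_lt {m : ℕ} (d : Fin m → Series m) {η ν : Word m}
    (h : ν.length < η.length) : phi m d η (one m) ν = 0 := by
  induction η generalizing ν with
  | nil => simp at h
  | cons i η ih =>
    cases ν with
    | nil => simp [phi, phiStep, cat]
    | cons j ν =>
      have hlt : ν.length < η.length := by simpa using h
      have hsh : sh m (dsel m d i) (phi m d η (one m)) ν = 0 := by
        rw [sh_congr (c' := dsel m d i) (d' := 0) (fun _ _ => rfl)
          fun ξ hξ => ih (hξ.trans_lt hlt), sh_zero_right, Pi.zero_apply]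
      simp [phi, phiStep, cat, ih hlt, hsh]

theorem modcomp_apply_eq_sum {m n : ℕ} (c : Series m) (d : Fin m → Series m) {ν : Word m}
    (h : ν.length ≤ n) :
    modcomp m c d ν = ∑ η ∈ wordsLE m n, c η * phi m d η (one m) ν := by
  rw [modcomp, finsum_eq_sum_of_support_subset]
  intro η hη
  rw [Finset.mem_coe, mem_wordsLE]
  by_contra! hlt
  exact right_ne_zero_of_mul hη (phi_one_eq_zero_of_length_lt d (h.trans_lt hlt))

theorem modcomp_linear {m : ℕ} (α β : ℝ) (c c' : Series m) (d : Fin m → Series m) :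
    modcomp m (α • c + β • c') d = α • modcomp m c d + β • modcomp m c' d := by
  funext ν
  simp only [Pi.add_apply, Pi.smul_apply, smul_eq_mul, modcomp_apply_eq_sum _ d (le_refl ν.length),
    Finset.mul_sum, ← Finset.sum_add_distrib]
  refine Finset.sum_congr rfl fun η _ => ?_
  ring

theorem modcomp_add {m : ℕ} (c c' : Series m) (d : Fin m → Series m) :
    modcomp m (c + c') d = modcomp m c d + modcomp m c' d := by
  simpa using modcomp_linear 1 1 c c' d

theorem modcomp_zero_left {m : ℕ} (d : Fin m → Series m) : modcomp m 0 d = 0 := by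
  simpa using modcomp_linear 0 0 0 0 d

theorem modcomp_nil {m : ℕ} (c : Series m) (d : Fin m → Series m) : modcomp m c d [] = c [] := by
  rw [modcomp_apply_eq_sum c d (Nat.le_refl 0)]
  simp [wordsLE, phi, one]

theorem sh_modcomp_apply {m : ℕ} (e c : Series m) (d : Fin m → Series m) (ν : Word m) :
    sh m e (modcomp m c d) ν =
      ∑ η ∈ wordsLE m ν.length, c η * sh m e (phi m d η (one m)) ν := by
  rw [sh_congr (c' := e) (d' := ∑ η ∈ wordsLE m ν.length, c η • phi m d η (one m))
    (fun _ _ => rfl) fun ξ hξ => by simp [modcomp_apply_eq_sum c d hξ], sh_sum_right]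
  simp [sh_smul_right]

theorem modcomp_cons {m : ℕ} (c : Series m) (d : Fin m → Series m) (j : Fin (m + 1))
    (ν : Word m) :
    modcomp m c d (j :: ν) = modcomp m (leftDeriv j c) d ν +
      if j = 0 then ∑ i, sh m (dsel m d i) (modcomp m (leftDeriv i c) d) ν else 0 := by
  rw [modcomp_apply_eq_sum c d (n := ν.length + 1) (by simp), sum_wordsLE_succ,
    modcomp_apply_eq_sum (leftDeriv j c) d le_rfl]
  simp only [sh_modcomp_apply, phi, phiStep, cat, one, leftDeriv, Pi.add_apply, mul_add, mul_ite,
    mul_zero, Finset.sum_add_distrib, Finset.sum_ite_irrel, Finset.sum_const_zero,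
    Finset.sum_ite_eq, Finset.mem_univ, if_true, reduceCtorEq, if_false, zero_add]

theorem leftDeriv_cat {m : ℕ} (i j : Fin (m + 1)) (c : Series m) :
    leftDeriv j (cat m i c) = if j = i then c else 0 := by
  funext ν
  by_cases h : j = i <;> simp [leftDeriv, cat, h]

theorem modcomp_cat {m : ℕ} (i : Fin (m + 1)) (c : Series m) (d : Fin m → Series m) :
    modcomp m (cat m i c) d = phiStep m d i (modcomp m c d) := by
  funext ν
  cases ν with
  | nil => simp [modcomp_nil, phiStep, cat]
  | cons j ν =>
    have hderiv (k : Fin (m + 1)) : modcomp m (leftDeriv k (cat m i c)) d =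
        if k = i then modcomp m c d else 0 := by
      rw [leftDeriv_cat]
      split_ifs <;> simp [modcomp_zero_left]
    have hsum : ∑ k, sh m (dsel m d k) (if k = i then modcomp m c d else 0) ν =
        sh m (dsel m d i) (modcomp m c d) ν := by
      rw [Finset.sum_eq_single i (fun k _ hk => by simp [hk, sh_zero_right]) (by simp)]
      simp
    rw [modcomp_cons]
    simp only [hderiv, hsum, phiStep, cat, Pi.add_apply]
    split_ifs <;> rfl

theorem modcomp_zero_right {m : ℕ} (c : Series m) : modcomp m c 0 = c := by
  have hdsel (i : Fin (m + 1)) : dsel m 0 i = 0 := by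
    unfold dsel
    split_ifs <;> rfl
  funext ν
  induction ν generalizing c with
  | nil => exact modcomp_nil c 0
  | cons j ν ih => simp [modcomp_cons, hdsel, sh_zero_left, ih, leftDeriv]

theorem eq_zero_of_modcomp_eq_zero {m : ℕ} {c : Series m} {d : Fin m → Series m}
    (h : modcomp m c d = 0) : c = 0 := by
  funext ν
  induction ν generalizing c with
  | nil => rw [← modcomp_nil c d, h]
  | cons j ν ih =>
    have hne (i : Fin (m + 1)) (hi : i ≠ 0) : modcomp m (leftDeriv i c) d = 0 := by
      funext ξ
      simpa [hi, h] using (modcomp_cons c d i ξ).symm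
    have hall (i : Fin (m + 1)) : modcomp m (leftDeriv i c) d = 0 := by
      rcases eq_or_ne i 0 with rfl | hi
      · funext ξ
        have hsum : ∑ i, sh m (dsel m d i) (modcomp m (leftDeriv i c) d) ξ = 0 := by
          refine Finset.sum_eq_zero fun i _ => ?_
          rcases eq_or_ne i 0 with rfl | hi
          · simp [dsel, sh_zero_left]
          · simp [hne i hi, sh_zero_right]
        simpa [hsum, h] using (modcomp_cons c d 0 ξ).symm
      · exact hne i hi
    exact ih (hall j)

theorem modcomp_smul_one {m : ℕ} (a : ℝ) (d : Fin m → Series m) :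
    modcomp m (a • one m) d = a • one m := by
  have hderiv (i : Fin (m + 1)) : leftDeriv i (a • one m) = 0 := by
    funext ν
    simp [leftDeriv, one]
  funext ν
  cases ν with
  | nil => exact modcomp_nil _ d
  | cons j ν => simp [modcomp_cons, hderiv, modcomp_zero_left, sh_zero_right, one]

theorem modcomp_eq_smul_one_iff {m : ℕ} (c : Series m) (d : Fin m → Series m) (a : ℝ) :
    modcomp m c d = a • one m ↔ c = a • one m := by
  refine ⟨fun h => sub_eq_zero.1 (eq_zero_of_modcomp_eq_zero (d := d) ?_), ?_⟩
  · have := modcomp_linear 1 (-1) c (a • one m) d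
    simpa [h, modcomp_smul_one, ← sub_eq_add_neg] using this
  · rintro rfl
    exact modcomp_smul_one a d

theorem leftDeriv_modcomp {m : ℕ} (j : Fin (m + 1)) (c : Series m) (d : Fin m → Series m) :
    leftDeriv j (modcomp m c d) = modcomp m (leftDeriv j c) d +
      if j = 0 then ∑ i, sh m (dsel m d i) (modcomp m (leftDeriv i c) d) else 0 := by
  funext ν
  rw [leftDeriv, modcomp_cons]
  split_ifs <;> simp

theorem modcomp_sh {m : ℕ} (c c' : Series m) (d : Fin m → Series m) :
    modcomp m (sh m c c') d = sh m (modcomp m c d) (modcomp m c' d) := by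
  suffices h : ∀ (n : ℕ) (c c' : Series m) (ν : Word m), ν.length ≤ n →
      modcomp m (sh m c c') d ν = sh m (modcomp m c d) (modcomp m c' d) ν from
    funext fun ν => h ν.length c c' ν le_rfl
  intro n
  induction n with
  | zero =>
    intro c c' ν hν
    obtain rfl : ν = [] := List.length_eq_zero_iff.1 (Nat.le_zero.1 hν)
    rw [modcomp_nil, sh_nil, sh_nil, modcomp_nil, modcomp_nil]
  | succ n ih =>
    intro c c' ν hν
    cases ν with
    | nil => rw [modcomp_nil, sh_nil, sh_nil, modcomp_nil, modcomp_nil]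
    | cons j ν =>
      have hn : ν.length ≤ n := by simpa using hν
      have hsh (e a b : Series m) : sh m e (modcomp m (sh m a b) d) ν =
          sh m e (sh m (modcomp m a d) (modcomp m b d)) ν :=
        sh_congr (fun _ _ => rfl) fun ξ hξ => ih a b ξ (hξ.trans hn)
      rw [modcomp_cons, sh_cons, leftDeriv_modcomp, leftDeriv_modcomp]
      simp only [leftDeriv_sh, modcomp_add, sh_add_left, sh_add_right, Pi.add_apply, ih _ _ ν hn,
        hsh]
      split_ifs
      · rw [sh_comm (∑ i, _), sh_sum_right, sh_sum_right]
        simp only [Finset.sum_add_distrib, Finset.sum_apply]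
        have hl (i : Fin (m + 1)) : sh m (modcomp m c' d)
            (sh m (dsel m d i) (modcomp m (leftDeriv i c) d)) =
            sh m (dsel m d i) (sh m (modcomp m (leftDeriv i c) d) (modcomp m c' d)) := by
          rw [sh_comm, sh_assoc]
        simp only [hl, sh_left_comm (modcomp m c d) (dsel m d _)]
        ring
      · simp [sh_zero_left, sh_zero_right]

end ModifiedComposition

/-- Elementary properties of the modified composition product:
(1) left ℝ-linearity; (2) `c ∘̃ 0 = c`; (3) `c ∘̃ d = k` iff `c = k` for constants
`k ∈ ℝ^ℓ`; (4) `(x_0 c) ∘̃ d = x_0 (c ∘̃ d)` and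
`(x_i c) ∘̃ d = x_i (c ∘̃ d) + x_0 (d_i ⧢ (c ∘̃ d))` for `1 ≤ i ≤ m`;
(5) left distributivity over the shuffle product. -/
theorem modcomp_properties (m ℓ : ℕ) :
    (∀ (α β : ℝ) (c c' : Series m) (d : Fin m → Series m),
      modcomp m (α • c + β • c') d = α • modcomp m c d + β • modcomp m c' d) ∧
    (∀ c : Series m, modcomp m c 0 = c) ∧
    (∀ (c : Fin ℓ → Series m) (d : Fin m → Series m) (k : Fin ℓ → ℝ),
      modcompV m c d = constV m k ↔ c = constV m k) ∧
    (∀ (c : Series m) (d : Fin m → Series m),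
      modcomp m (cat m 0 c) d = cat m 0 (modcomp m c d) ∧
      ∀ i : Fin m, modcomp m (cat m i.succ c) d
        = cat m i.succ (modcomp m c d) + cat m 0 (sh m (d i) (modcomp m c d))) ∧
    (∀ (c c' : Series m) (d : Fin m → Series m),
      modcomp m (sh m c c') d = sh m (modcomp m c d) (modcomp m c' d)) := by
  refine ⟨modcomp_linear, modcomp_zero_right, fun c d k => ?_, fun c d => ⟨?_, fun i => ?_⟩,
    modcomp_sh⟩
  · simp only [funext_iff (f := modcompV m c d), funext_iff (f := c)]
    exact forall_congr' fun j => modcomp_eq_smul_one_iff (c j) d (k j)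
  · rw [modcomp_cat, phiStep, dsel, dif_pos rfl, sh_zero_left]
    funext ν
    cases ν <;> simp [cat]
  · rw [modcomp_cat, phiStep, dsel, dif_neg (Fin.succ_ne_zero i), Fin.pred_succ]

end

end FliessStmt
end

section
/- In the Hopf algebra H of coordinate functions, for every nonempty word η over the reduced alphabet X̃ = X ∖ {x_0} = {x_1,…,x_m} and every 1 ≤ l ≤ m, the generator a^l_η is primitive: Δ a^l_η = a^l_η ⊗ 1 + 1 ⊗ a^l_η. Moreover, for 1 ≤ i ≤ m, Δ a^l_{x_0} = a^l_{x_0} ⊗ 1 + 1 ⊗ a^l_{x_0} + Σ_{j=1}^m a^l_{x_j} ⊗ a^j_∅, and Δ a^l_{x_i x_0} = a^l_{x_i x_0} ⊗ 1 + 1 ⊗ a^l_{x_i x_0} + Σ_{j=1}^m a^l_{x_i x_j} ⊗ a^j_∅. -/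
open scoped TensorProduct BigOperators

namespace FeedbackHopf

/-- Words over the alphabet `X = {x_0, …, x_m}`. -/
abbrev Word (m : ℕ) := List (Fin (m + 1))

/-- `H`: the free commutative polynomial ℝ-algebra on the coordinate-function
generators `a^k_η`, `η ∈ X*`, `1 ≤ k ≤ m`. -/
abbrev H (m : ℕ) := MvPolynomial (Fin m × Word m) ℝ

noncomputable section

variable (m : ℕ)

/-- The generator (coordinate function) `a^k_η`. -/
def gen (k : Fin m) (η : Word m) : H m := MvPolynomial.X (k, η)

/-- The right-shift map `θ̃_j`: the derivation of `H` with `θ̃_j a^k_η = a^k_{η x_j}`. -/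
def theta (j : Fin (m + 1)) : H m →ₗ[ℝ] H m :=
  (MvPolynomial.mkDerivation ℝ fun p : Fin m × Word m =>
    (MvPolynomial.X (p.1, p.2 ++ [j]) : H m)).toLinearMap

/-- The map `A^{(j)} : H → H`, multiplication by `a^j_∅`. -/
def Ae (j : Fin m) : H m →ₗ[ℝ] H m := LinearMap.mulRight ℝ (gen m j [])

/-- `Θ̃_i := θ̃_i ⊗ id + id ⊗ θ̃_i + δ_{0i} Σ_{j=1}^m θ̃_j ⊗ A^{(j)}` on `H ⊗ H`. -/
def thetaT (i : Fin (m + 1)) : H m ⊗[ℝ] H m →ₗ[ℝ] H m ⊗[ℝ] H m :=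
  TensorProduct.map (theta m i) LinearMap.id
    + TensorProduct.map LinearMap.id (theta m i)
    + (if i = 0 then ∑ j : Fin m, TensorProduct.map (theta m j.succ) (Ae m j) else 0)

/-- `Θ̃_η := Θ̃_{i_n} ∘ ⋯ ∘ Θ̃_{i_1}` for `η = x_{i_1} ⋯ x_{i_n}`, `Θ̃_∅ = id`. -/
def thetaTw : Word m → (H m ⊗[ℝ] H m →ₗ[ℝ] H m ⊗[ℝ] H m)
  | [] => LinearMap.id
  | i :: η => thetaTw η ∘ₗ thetaT m i

/-- The coproduct `Δ`, defined on generators by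
`Δ a^l_η := Θ̃_η (a^l_∅ ⊗ 1 + 1 ⊗ a^l_∅)` and extended as an algebra morphism. -/
def Delta : H m →ₐ[ℝ] H m ⊗[ℝ] H m :=
  MvPolynomial.aeval fun p : Fin m × Word m =>
    thetaTw m p.2 (gen m p.1 [] ⊗ₜ[ℝ] 1 + 1 ⊗ₜ[ℝ] gen m p.1 [])

/-- The counit `ε`, with `ε(a^k_η) = 0` and `ε(1) = 1`. -/
def counit : H m →ₐ[ℝ] ℝ := MvPolynomial.aeval fun _ => (0 : ℝ)

lemma theta_gen (j : Fin (m + 1)) (k : Fin m) (η : Word m) :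
    theta m j (gen m k η) = gen m k (η ++ [j]) := by
  simp [theta, gen, MvPolynomial.mkDerivation_X]

lemma theta_one (j : Fin (m + 1)) : theta m j 1 = 0 := by
  simp [theta]

lemma Delta_gen (l : Fin m) (η : Word m) :
    Delta m (gen m l η) = thetaTw m η (gen m l [] ⊗ₜ[ℝ] 1 + 1 ⊗ₜ[ℝ] gen m l []) := by
  rw [Delta, gen, MvPolynomial.aeval_X]

lemma thetaT_gen_of_ne_zero {i : Fin (m + 1)} (hi : i ≠ 0) (l : Fin m) (w : Word m) :
    thetaT m i (gen m l w ⊗ₜ[ℝ] 1 + 1 ⊗ₜ[ℝ] gen m l w)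
      = gen m l (w ++ [i]) ⊗ₜ[ℝ] 1 + 1 ⊗ₜ[ℝ] gen m l (w ++ [i]) := by
  simp [thetaT, hi, theta_gen, theta_one]

lemma thetaT_zero_gen (l : Fin m) (w : Word m) :
    thetaT m 0 (gen m l w ⊗ₜ[ℝ] 1 + 1 ⊗ₜ[ℝ] gen m l w)
      = gen m l (w ++ [0]) ⊗ₜ[ℝ] 1 + 1 ⊗ₜ[ℝ] gen m l (w ++ [0])
        + ∑ j : Fin m, gen m l (w ++ [j.succ]) ⊗ₜ[ℝ] gen m j [] := by
  simp [thetaT, theta_gen, theta_one, Ae, LinearMap.sum_apply]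

lemma thetaTw_gen_of_forall_ne_zero (l : Fin m) (η : Word m) (hη : ∀ a ∈ η, a ≠ 0)
    (w : Word m) :
    thetaTw m η (gen m l w ⊗ₜ[ℝ] 1 + 1 ⊗ₜ[ℝ] gen m l w)
      = gen m l (w ++ η) ⊗ₜ[ℝ] 1 + 1 ⊗ₜ[ℝ] gen m l (w ++ η) := by
  induction η generalizing w with
  | nil => simp [thetaTw]
  | cons i η ih =>
    rw [List.forall_mem_cons] at hη
    rw [thetaTw, LinearMap.comp_apply, thetaT_gen_of_ne_zero m hη.1, ih hη.2,
      List.append_assoc, List.singleton_append]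

/-- Generators indexed by nonempty words over the reduced
alphabet `X̃ = X ∖ {x_0}` are primitive; moreover
`Δ a^l_{x_0} = a^l_{x_0} ⊗ 1 + 1 ⊗ a^l_{x_0} + Σ_{j=1}^m a^l_{x_j} ⊗ a^j_∅` and
`Δ a^l_{x_i x_0} = a^l_{x_i x_0} ⊗ 1 + 1 ⊗ a^l_{x_i x_0} + Σ_{j=1}^m a^l_{x_i x_j} ⊗ a^j_∅`
for `1 ≤ i ≤ m`. -/
theorem primitive_and_x0_coproducts (m : ℕ) :
    (∀ η : Word m, η ≠ [] → (∀ a ∈ η, a ≠ 0) → ∀ l : Fin m,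
      Delta m (gen m l η) = gen m l η ⊗ₜ[ℝ] 1 + 1 ⊗ₜ[ℝ] gen m l η) ∧
    (∀ l : Fin m,
      Delta m (gen m l [0])
        = gen m l [0] ⊗ₜ[ℝ] 1 + 1 ⊗ₜ[ℝ] gen m l [0]
          + ∑ j : Fin m, gen m l [j.succ] ⊗ₜ[ℝ] gen m j []) ∧
    (∀ (l : Fin m) (i : Fin m),
      Delta m (gen m l [i.succ, 0])
        = gen m l [i.succ, 0] ⊗ₜ[ℝ] 1 + 1 ⊗ₜ[ℝ] gen m l [i.succ, 0]
          + ∑ j : Fin m, gen m l [i.succ, j.succ] ⊗ₜ[ℝ] gen m j []) := by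
  refine ⟨fun η _ hη l => ?_, fun l => ?_, fun l i => ?_⟩
  · rw [Delta_gen, thetaTw_gen_of_forall_ne_zero m l η hη, List.nil_append]
  · rw [Delta_gen, thetaTw, thetaTw, LinearMap.id_comp, thetaT_zero_gen]
    simp only [List.nil_append]
  · rw [Delta_gen, thetaTw, thetaTw, thetaTw, LinearMap.id_comp, LinearMap.comp_apply,
      thetaT_gen_of_ne_zero m (Fin.succ_ne_zero i), thetaT_zero_gen]
    simp only [List.nil_append, List.singleton_append]

end

end FeedbackHopf
end
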